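/- Let p be an odd prime and n a positive integer not divisible by p, and let K be the unramified extension of ℚ_p of degree n. Let μ be the additive Haar measure on K normalized by μ(O) = 1, and let Γ : (0,∞) × [0,∞) → [0,∞] be measurable. Extend r to K by r(0) = 0. If x, x' ∈ K* satisfy r(x) = r(x'), then for every t > 0 and every Borel set B̃ ⊆ ℚ_p, ∫_{{y ∈ K : r(y) ∈ B̃}} Γ(t, ‖x − y‖) dμ(y) = ∫_{{y ∈ K : r(y) ∈ B̃}} Γ(t, ‖x' − y‖) dμ(y); in particular, the transition probability P_t(x, r^{−1}(B̃)) of a rotation-invariant homogeneous process with density Γ depends on x only through r(x). -/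

import Mathlib

open scoped Classical
noncomputable section

/-- The group `1 + pℤ_p` of principal units of `ℚ_p`. -/
def PUnits1 (p : ℕ) [Fact (Nat.Prime p)] : Set ℚ_[p] :=
  {u : ℚ_[p] | ‖u - 1‖ ≤ (p : ℝ)⁻¹}

/-- The multiplicative subgroup `ℚ_p^{(1)} = p^ℤ · (1 + pℤ_p)` of `ℚ_p^*`. -/
def Qp1 (p : ℕ) [Fact (Nat.Prime p)] : Set ℚ_[p] :=
  {z : ℚ_[p] | ∃ ν : ℤ, ∃ u ∈ PUnits1 p, z = (p : ℚ_[p]) ^ ν * u}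

/-- `ℚ_p^{(+)} = ℚ_p^{(1)} ∪ {0}`. -/
def QpPlus (p : ℕ) [Fact (Nat.Prime p)] : Set ℚ_[p] := Qp1 p ∪ {0}

/-- The ring of integers `O` of a normed field, i.e. the closed unit ball. -/
def ringO (K : Type) [NormedField K] : Set K := {x : K | ‖x‖ ≤ 1}

/-- The group `U₁ = 1 + pO` of principal units of `K`. -/
def U1 (p : ℕ) (K : Type) [NormedField K] : Set K :=
  {x : K | ∃ y ∈ ringO K, x = 1 + (p : K) * y}

/-- The group `μ_{q-1}` of `(q-1)`-st roots of unity of `K`. -/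
def muRoots (q : ℕ) (K : Type) [NormedField K] : Set K := {x : K | x ^ (q - 1) = 1}

/-- `ω : K → K` is a Teichmüller-component map: every `x ∈ K*` is uniquely
`x = p^ν · ω(x) · u` with `ω(x) ∈ μ_{q-1}` and `u ∈ U₁`. -/
def IsTeich (p q : ℕ) (K : Type) [NormedField K] (ω : K → K) : Prop :=
  ∀ x : K, x ≠ 0 →
    (ω x ∈ muRoots q K ∧ ∃ ν : ℤ, ∃ u ∈ U1 p K, x = (p : K) ^ ν * (ω x * u)) ∧
    ∀ (w : K) (ν : ℤ) (u : K), w ∈ muRoots q K → u ∈ U1 p K →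
      x = (p : K) ^ ν * (w * u) → w = ω x

/-- The compact group `Σ_n = {y ∈ K* : ω(y) = 1, N(y) = 1}`. -/
def SigmaN (p : ℕ) [Fact (Nat.Prime p)] (K : Type) [NormedField K] [Algebra ℚ_[p] K]
    (ω : K → K) : Set K :=
  {y : K | y ≠ 0 ∧ ω y = 1 ∧ Algebra.norm ℚ_[p] y = 1}

/-- `r : K* → ℚ_p^{(1)}`, `r(x) = (N(ω(x)⁻¹ x))^{1/n}`, the radial part of the
spherical coordinates (characterized by `r(x) ∈ ℚ_p^{(1)}` and `r(x)^n = N(ω(x)⁻¹ x)`,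
which determines it uniquely since `p ∤ n`). -/
def IsRadial (p n : ℕ) [Fact (Nat.Prime p)] (K : Type) [NormedField K] [Algebra ℚ_[p] K]
    (ω : K → K) (r : K → ℚ_[p]) : Prop :=
  ∀ x : K, x ≠ 0 → r x ∈ Qp1 p ∧ (r x) ^ n = Algebra.norm ℚ_[p] ((ω x)⁻¹ * x)

/-- `K` is the unramified extension of `ℚ_p` of degree `n`: it has degree `n`,
its norm is the normalized absolute value `‖x‖ = |N(x)|_p`, and its value group
is `q^ℤ`, `q = p^n` (i.e. the extension is unramified). -/
def IsUnramifiedDeg (p n : ℕ) [Fact (Nat.Prime p)] (K : Type) [NormedField K]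
    [Algebra ℚ_[p] K] : Prop :=
  Module.finrank ℚ_[p] K = n ∧
  (∀ x : K, ‖x‖ = ‖Algebra.norm ℚ_[p] x‖) ∧
  (∀ x : K, x ≠ 0 → ∃ m : ℤ, ‖x‖ = (p : ℝ) ^ ((n : ℤ) * m))

open MeasureTheory ENNReal

theorem PUnits1.norm_eq_one {p : ℕ} [hp : Fact (Nat.Prime p)] {u : ℚ_[p]} (hu : u ∈ PUnits1 p) :
    ‖u‖ = 1 := by
  have h1 : ‖u - 1‖ < 1 := lt_of_le_of_lt hu
    (inv_lt_one_of_one_lt₀ (by exact_mod_cast hp.out.one_lt))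
  have h2 := IsUltrametricDist.norm_add_eq_max_of_norm_ne_norm (x := u - 1) (y := 1)
    (by rw [norm_one]; exact h1.ne)
  rw [sub_add_cancel, norm_one, max_eq_right h1.le] at h2
  exact h2

/-- A principal unit of `ℚ_p` that is an `n`-th root of unity with `p ∤ n` is trivial. -/
theorem PUnits1.eq_one_of_pow_eq_one {p n : ℕ} [hp : Fact (Nat.Prime p)] (hpn : ¬ p ∣ n)
    {v : ℚ_[p]} (hv : v ∈ PUnits1 p) (h : v ^ n = 1) : v = 1 := by
  have hp1 : (p : ℝ)⁻¹ < 1 := inv_lt_one_of_one_lt₀ (by exact_mod_cast hp.out.one_lt)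
  have hpow : ∀ i : ℕ, ‖v ^ i - 1‖ ≤ (p : ℝ)⁻¹ := by
    intro i
    induction i with
    | zero => simp
    | succ i ih =>
      have e : v ^ (i + 1) - 1 = v ^ i * (v - 1) + (v ^ i - 1) := by ring
      rw [e]
      refine (IsUltrametricDist.norm_add_le_max _ _).trans (max_le ?_ ih)
      rw [norm_mul, norm_pow, PUnits1.norm_eq_one hv, one_pow, one_mul]
      exact hv
  by_contra hne
  have hsum : ∑ i ∈ Finset.range n, v ^ i = 0 := by
    have := mul_geom_sum v n
    rw [h, sub_self] at this
    exact (mul_eq_zero.mp this).resolve_left (sub_ne_zero.mpr hne)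
  have hle : ‖∑ i ∈ Finset.range n, (v ^ i - 1)‖ ≤ (p : ℝ)⁻¹ :=
    IsUltrametricDist.norm_sum_le_of_forall_le_of_nonneg (by positivity) fun i _ => hpow i
  rw [Finset.sum_sub_distrib, hsum, zero_sub, norm_neg] at hle
  simp only [Finset.sum_const, Finset.card_range, nsmul_eq_mul, mul_one] at hle
  have hlt := hle.trans_lt hp1
  rw [Padic.norm_natCast_lt_one_iff] at hlt
  exact hpn hlt

/-- Extraction of `n`-th roots in `ℚ_p^{(1)}` is unique when `p ∤ n`. -/
theorem Qp1.pow_left_injOn {p n : ℕ} [hp : Fact (Nat.Prime p)] (hn : n ≠ 0) (hpn : ¬ p ∣ n) :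
    Set.InjOn (fun z : ℚ_[p] => z ^ n) (Qp1 p) := by
  rintro _ ⟨ν, u, hu, rfl⟩ _ ⟨ν', u', hu', rfl⟩ h
  have hp0 : (p : ℚ_[p]) ≠ 0 := by exact_mod_cast hp.out.ne_zero
  have hu1 := PUnits1.norm_eq_one hu
  have hu1' := PUnits1.norm_eq_one hu'
  have hu0 : u' ≠ 0 := by
    rw [← norm_ne_zero_iff, hu1']
    exact one_ne_zero
  have hnorm := congrArg norm h
  simp only [norm_pow, norm_mul, norm_zpow, hu1, hu1', mul_one] at hnorm
  rw [pow_left_inj₀ (by positivity) (by positivity) hn, Padic.norm_p] at hnorm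
  have hν : ν = ν' := zpow_right_injective₀
    (inv_pos.mpr (by exact_mod_cast hp.out.pos))
    (inv_lt_one_of_one_lt₀ (by exact_mod_cast hp.out.one_lt : (1 : ℝ) < p)).ne hnorm
  subst hν
  have hpow : u ^ n = u' ^ n := by
    simp only [mul_pow] at h
    exact mul_left_cancel₀ (pow_ne_zero _ (zpow_ne_zero _ hp0)) h
  have hmem : u / u' ∈ PUnits1 p := by
    have e : u / u' - 1 = ((u - 1) - (u' - 1)) / u' := by
      field_simp
      ring
    change ‖u / u' - 1‖ ≤ _
    rw [e, norm_div, hu1', div_one, sub_eq_add_neg]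
    exact (IsUltrametricDist.norm_add_le_max _ _).trans (max_le hu ((norm_neg _).trans_le hu'))
  have hone := PUnits1.eq_one_of_pow_eq_one hpn hmem
    (by rw [div_pow, hpow, div_self (pow_ne_zero _ hu0)])
  rw [(div_eq_one_iff_eq hu0).mp hone]

section Unramified

variable {p n : ℕ} [Fact (Nat.Prime p)] {K : Type} [NormedField K] [Algebra ℚ_[p] K]

theorem IsUnramifiedDeg.norm_algebraMap (hK : IsUnramifiedDeg p n K) (c : ℚ_[p]) :
    ‖algebraMap ℚ_[p] K c‖ = ‖c‖ ^ n := by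
  rw [hK.2.1, Algebra.norm_algebraMap, hK.1, norm_pow]

theorem IsUnramifiedDeg.isUltrametricDist (hK : IsUnramifiedDeg p n K) : IsUltrametricDist K := by
  refine IsUltrametricDist.isUltrametricDist_of_forall_norm_natCast_le_one fun m => ?_
  rw [← map_natCast (algebraMap ℚ_[p] K), hK.norm_algebraMap]
  exact pow_le_one₀ (norm_nonneg _) (IsUltrametricDist.norm_natCast_le_one _ _)

theorem IsUnramifiedDeg.continuousSMul (hn : n ≠ 0) (hK : IsUnramifiedDeg p n K) :
    ContinuousSMul ℚ_[p] K := by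
  refine continuousSMul_of_algebraMap ℚ_[p] K ?_
  refine continuous_of_continuousAt_zero (algebraMap ℚ_[p] K) ?_
  rw [ContinuousAt, map_zero, tendsto_zero_iff_norm_tendsto_zero]
  simp only [hK.norm_algebraMap]
  have h : Continuous fun c : ℚ_[p] => ‖c‖ ^ n := by fun_prop
  simpa [hn] using h.tendsto 0

/-- The unramified extension, with its normalized absolute value, is homeomorphic to `ℚ_p ^ n`. -/
theorem IsUnramifiedDeg.nonempty_homeomorph [FiniteDimensional ℚ_[p] K] (hn : n ≠ 0)
    (hK : IsUnramifiedDeg p n K) : Nonempty (K ≃ₜ (Fin n → ℚ_[p])) := by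
  have := hK.continuousSMul hn
  exact ⟨(ContinuousLinearEquiv.ofFinrankEq (𝕜 := ℚ_[p]) (E := K) (F := Fin n → ℚ_[p])
    (by simp [hK.1])).toHomeomorph⟩

/-- Multiplication by an element of absolute value one preserves Haar measure. -/
theorem IsUnramifiedDeg.measurePreserving_mul_left [FiniteDimensional ℚ_[p] K] (hn : n ≠ 0)
    (hK : IsUnramifiedDeg p n K) [MeasurableSpace K] [BorelSpace K]
    (μK : Measure K) [μK.IsAddHaarMeasure] (hμK : μK (ringO K) = 1) {a : K} (ha : ‖a‖ = 1) :
    MeasurePreserving (fun y => a * y) μK μK := by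
  obtain ⟨e⟩ := hK.nonempty_homeomorph hn
  have : LocallyCompactSpace K := e.isClosedEmbedding.locallyCompactSpace
  have : SecondCountableTopology K := e.secondCountableTopology
  have ha0 : a ≠ 0 := by
    rw [← norm_ne_zero_iff, ha]
    exact one_ne_zero
  have hm : Measurable fun y : K => a * y := (continuous_const_mul a).measurable
  refine ⟨hm, ?_⟩
  have : (μK.map (fun y : K => a * y)).IsAddHaarMeasure :=
    Measure.isAddHaarMeasure_map μK (AddMonoidHom.mulLeft a)
      (continuous_const_mul a) (fun y => ⟨a⁻¹ * y, by simp [ha0]⟩)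
      (Homeomorph.mulLeft₀ a ha0).isClosedEmbedding.tendsto_cocompact
  have hpre : (fun y : K => a * y) ⁻¹' ringO K = ringO K := by
    ext y
    simp [ringO, ha]
  have hms : MeasurableSet (ringO K) :=
    (isClosed_le continuous_norm continuous_const).measurableSet
  have hs := Measure.isAddLeftInvariant_eq_smul (μK.map (fun y : K => a * y)) μK
  have hc := congrArg (fun ν : Measure K => ν (ringO K)) hs
  simp only [Measure.map_apply hm hms, hpre, Measure.smul_apply, hμK] at hc
  have hc1 : Measure.addHaarScalarFactor (μK.map fun y : K => a * y) μK = 1 := by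
    simpa [ENNReal.smul_def] using hc.symm
  rw [hs, hc1, one_smul]

end Unramified

section Teichmuller

variable {p q : ℕ} {K : Type} [NormedField K] {ω : K → K}

theorem U1.mul_mem [IsUltrametricDist K] {u v : K} (hu : u ∈ U1 p K) (hv : v ∈ U1 p K) :
    u * v ∈ U1 p K := by
  obtain ⟨y, hy, rfl⟩ := hu
  obtain ⟨z, hz, rfl⟩ := hv
  refine ⟨y + z + p * (y * z), ?_, by ring⟩
  have hyz : ‖(p : K) * (y * z)‖ ≤ 1 := by
    rw [norm_mul, norm_mul]
    exact mul_le_one₀ (IsUltrametricDist.norm_natCast_le_one K p) (by positivity)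
      (mul_le_one₀ hy (norm_nonneg _) hz)
  exact (IsUltrametricDist.norm_add_le_max _ _).trans
    (max_le ((IsUltrametricDist.norm_add_le_max _ _).trans (max_le hy hz)) hyz)

theorem IsTeich.map_mul [IsUltrametricDist K] (hp : (p : K) ≠ 0) (hω : IsTeich p q K ω)
    {x y : K} (hx : x ≠ 0) (hy : y ≠ 0) : ω (x * y) = ω x * ω y := by
  obtain ⟨⟨hwx, ν, u, hu, ex⟩, -⟩ := hω x hx
  obtain ⟨⟨hwy, ν', u', hu', ey⟩, -⟩ := hω y hy
  refine ((hω (x * y) (mul_ne_zero hx hy)).2 (ω x * ω y) (ν + ν') (u * u') ?_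
    (U1.mul_mem hu hu') ?_).symm
  · change (ω x * ω y) ^ (q - 1) = 1
    rw [mul_pow, hwx, hwy, one_mul]
  · rw [zpow_add₀ hp]
    nth_rw 1 [ex, ey]
    ring

theorem IsTeich.norm_eq_one (hq : 1 < q) (hω : IsTeich p q K ω) {x : K} (hx : x ≠ 0) :
    ‖ω x‖ = 1 :=
  (pow_eq_one_iff_of_nonneg (norm_nonneg _) (Nat.sub_ne_zero_of_lt hq)).mp <| by
    rw [← norm_pow, (hω x hx).1.1, norm_one]

end Teichmuller

/-- For a rotation-invariant homogeneous process on `K` with transition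
density `Γ(t, ‖x-y‖)`, the transition probability `P_t(x, r⁻¹(B̃))` depends on `x` only
through `r(x)`: if `r(x) = r(x')` then
`∫_{r(y) ∈ B̃} Γ(t, ‖x-y‖) dμ(y) = ∫_{r(y) ∈ B̃} Γ(t, ‖x'-y‖) dμ(y)`. -/
theorem radial_transition_probability_well_defined
    (p n q : ℕ) [Fact (Nat.Prime p)] (hp2 : p ≠ 2) (hn : 0 < n) (hpn : ¬ p ∣ n)
    (hq : q = p ^ n)
    (K : Type) [NormedField K] [Algebra ℚ_[p] K] [FiniteDimensional ℚ_[p] K]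
    (hK : IsUnramifiedDeg p n K)
    (ω : K → K) (hω : IsTeich p q K ω)
    (r : K → ℚ_[p]) (hr : IsRadial p n K ω r) (hr0 : r 0 = 0)
    [MeasurableSpace K] [BorelSpace K] [MeasurableSpace ℚ_[p]] [BorelSpace ℚ_[p]]
    (μK : Measure K) [μK.IsAddHaarMeasure] (hμK : μK (ringO K) = 1)
    (Γ : ℝ → ℝ → ℝ≥0∞) (hΓ : Measurable fun z : ℝ × ℝ => Γ z.1 z.2) :
    ∀ x x' : K, x ≠ 0 → x' ≠ 0 → r x = r x' →
      ∀ t : ℝ, 0 < t → ∀ B : Set ℚ_[p], MeasurableSet B →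
        ∫⁻ y in {y : K | r y ∈ B}, Γ t ‖x - y‖ ∂μK
          = ∫⁻ y in {y : K | r y ∈ B}, Γ t ‖x' - y‖ ∂μK := by
  intro x x' hx hx' hxx t _ B _
  have hp : p.Prime := Fact.out
  have hn0 : n ≠ 0 := hn.ne'
  have hq1 : 1 < q := hq ▸ Nat.one_lt_pow hn0 hp.one_lt
  have := hK.isUltrametricDist
  have hpK : (p : K) ≠ 0 := by
    rw [← map_natCast (algebraMap ℚ_[p] K), map_ne_zero]
    exact_mod_cast hp.ne_zero
  have hω0 : ∀ {y : K}, y ≠ 0 → ω y ≠ 0 := fun hy => by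
    rw [← norm_ne_zero_iff, hω.norm_eq_one hq1 hy]
    exact one_ne_zero
  obtain ⟨a, rfl⟩ : ∃ a, x' = a * x := ⟨x' / x, (div_mul_cancel₀ _ hx).symm⟩
  have ha0 : a ≠ 0 := left_ne_zero_of_mul hx'
  have hrmul : ∀ y : K, y ≠ 0 →
      r (a * y) ^ n = Algebra.norm ℚ_[p] ((ω a)⁻¹ * a) * r y ^ n := by
    intro y hy
    rw [(hr _ (mul_ne_zero ha0 hy)).2, (hr y hy).2, ← map_mul, hω.map_mul hpK ha0 hy]
    congr 1
    rw [mul_inv]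
    ring
  have hNa : Algebra.norm ℚ_[p] ((ω a)⁻¹ * a) = 1 := by
    have h := hrmul x hx
    rw [← hxx] at h
    have hrx : r x ^ n ≠ 0 := by
      rw [(hr x hx).2]
      exact Algebra.norm_ne_zero_iff.mpr (mul_ne_zero (inv_ne_zero (hω0 hx)) hx)
    exact (mul_eq_right₀ hrx).mp h.symm
  have ha : ‖a‖ = 1 := by
    have h := hK.2.1 ((ω a)⁻¹ * a)
    rwa [hNa, norm_mul, norm_inv, hω.norm_eq_one hq1 ha0, inv_one, one_mul, norm_one] at h
  have hrinv : ∀ y : K, r (a * y) = r y := by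
    intro y
    rcases eq_or_ne y 0 with rfl | hy
    · rw [mul_zero]
    · refine Qp1.pow_left_injOn hn0 hpn (hr _ (mul_ne_zero ha0 hy)).1 (hr y hy).1 ?_
      simpa [hNa] using hrmul y hy
  have hmp := hK.measurePreserving_mul_left hn0 μK hμK ha
  have h := hmp.setLIntegral_comp_preimage_emb
    (Homeomorph.mulLeft₀ a ha0).measurableEmbedding (fun y => Γ t ‖a * x - y‖) {y | r y ∈ B}
  rw [← h]
  simp only [Set.preimage_ofPred_eq, hrinv, ← mul_sub, norm_mul, ha, one_mul]
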